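/- Let R be a commutative Noetherian ring and let I be an ideal of R generated by r elements f₁, …, f_r. Then for every R-module M, the local cohomology modules H^i_I(M) vanish for all i > r. -/

import Mathlib

/-!
STATEMENT 4: Let `R` be a commutative Noetherian ring and `I` an ideal
generated by `r` elements `f₁, …, f_r`.  Then for every `R`-module `M`, the
local cohomology modules `H^i_I(M)` vanish for all `i > r`.
-/

open CategoryTheory Limits

universe u

/-- The submodule of elements of `M` killed by some power of the ideal `J`. -/
def Ideal.powTorsion {R : Type*} [CommRing R] (J : Ideal R) (M : Type*) [AddCommGroup M]
    [Module R M] : Submodule R M where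
  carrier := {x | ∃ n : ℕ, ∀ a ∈ J ^ n, a • x = 0}
  zero_mem' := ⟨0, by simp⟩
  add_mem' := by
    rintro x y ⟨m, hx⟩ ⟨n, hy⟩
    refine ⟨m + n, fun a ha ↦ ?_⟩
    rw [smul_add, hx a (Ideal.pow_le_pow_right (Nat.le_add_right m n) ha),
      hy a (Ideal.pow_le_pow_right (Nat.le_add_left n m) ha), add_zero]
  smul_mem' := by
    rintro c x ⟨n, hx⟩
    exact ⟨n, fun a ha ↦ by rw [smul_comm, hx a ha, smul_zero]⟩

namespace Ideal

variable {R : Type*} [CommRing R]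

theorem map_mem_powTorsion {J : Ideal R} {M N : Type*} [AddCommGroup M] [Module R M]
    [AddCommGroup N] [Module R N] (φ : M →ₗ[R] N) {x : M} (hx : x ∈ J.powTorsion M) :
    φ x ∈ J.powTorsion N := by
  obtain ⟨n, hn⟩ := hx
  exact ⟨n, fun a ha ↦ by rw [← map_smul, hn a ha, map_zero]⟩

theorem mem_powTorsion_bot {M : Type*} [AddCommGroup M] [Module R M] (x : M) :
    x ∈ (⊥ : Ideal R).powTorsion M :=
  ⟨1, by simp⟩

theorem mem_powTorsion_sup_span_singleton_iff {J : Ideal R} {g : R} {M : Type*} [AddCommGroup M]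
    [Module R M] {x : M} :
    x ∈ (J ⊔ Ideal.span {g}).powTorsion M ↔ x ∈ J.powTorsion M ∧ ∃ n : ℕ, g ^ n • x = 0 := by
  constructor
  · rintro ⟨n, hn⟩
    exact ⟨⟨n, fun a ha ↦ hn a (Ideal.pow_right_mono le_sup_left n ha)⟩, n,
      hn _ (Ideal.pow_mem_pow (le_sup_right (a := J) (Ideal.mem_span_singleton_self g)) n)⟩
  · rintro ⟨⟨m, hm⟩, n, hn⟩
    refine ⟨m + n, fun a ha ↦ ?_⟩
    have := Ideal.sup_pow_add_le_pow_sup_pow ha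
    rw [Ideal.span_singleton_pow] at this
    obtain ⟨b, hb, c, hc, rfl⟩ := Submodule.mem_sup.mp this
    obtain ⟨c, rfl⟩ := Ideal.mem_span_singleton'.mp hc
    rw [add_smul, hm b hb, mul_smul, hn, smul_zero, add_zero]

/-- Multiplication by `g ^ n` is surjective on the localization at `g` of the `J`-power torsion of
an injective module over a Noetherian ring. -/
theorem exists_pow_smul_sub_eq_zero_of_injective [IsNoetherianRing R]
    {E : Type*} [AddCommGroup E] [Module R E] (hE : Module.Baer R E)
    (J : Ideal R) (g : R) (n : ℕ) {x : E} (hx : x ∈ J.powTorsion E) :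
    ∃ y ∈ J.powTorsion E, ∃ k : ℕ, g ^ k • (x - g ^ n • y) = 0 := by
  obtain ⟨k, hk⟩ : ∃ k, ∀ b : R, g ^ n * g ^ k * b = 0 → g ^ k * b = 0 := by
    obtain ⟨k, hk⟩ := monotone_stabilizes_iff_noetherian.mpr inferInstance
      ⟨fun k ↦ Submodule.torsionBy R R (g ^ k), fun a b hab x hx ↦ by
        simp only [Submodule.mem_torsionBy_iff, smul_eq_mul] at hx ⊢
        rw [← Nat.sub_add_cancel hab, pow_add, mul_assoc, hx, mul_zero]⟩
    refine ⟨k, fun b hb ↦ ?_⟩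
    have : b ∈ Submodule.torsionBy R R (g ^ (n + k)) := by
      simpa [Submodule.mem_torsionBy_iff, pow_add] using hb
    rw [show Submodule.torsionBy R R (g ^ (n + k)) = Submodule.torsionBy R R (g ^ k) from
      (hk (n + k) (Nat.le_add_left k n)).symm] at this
    simpa [Submodule.mem_torsionBy_iff] using this
  obtain ⟨m, hm⟩ := hx
  obtain ⟨c, hc⟩ := J.exists_pow_inf_eq_pow_smul (M := R) (Ideal.span {g ^ n * g ^ k})
  let p : R →ₗ[R] R ⧸ J ^ (m + c) :=
    LinearMap.toSpanSingleton R _ (Ideal.Quotient.mk _ (g ^ n * g ^ k))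
  let q : R →ₗ[R] E := LinearMap.toSpanSingleton R E (g ^ k • x)
  have hpq : LinearMap.ker p ≤ LinearMap.ker q := by
    intro a ha
    have ha' : g ^ n * g ^ k * a ∈ J ^ (m + c) ⊓ Ideal.span {g ^ n * g ^ k} := by
      refine ⟨?_, Ideal.mul_mem_right _ _ (Ideal.mem_span_singleton_self _)⟩
      rw [SetLike.mem_coe, ← Ideal.Quotient.eq_zero_iff_mem, mul_comm]
      exact ha
    have h := hc (m + c) (Nat.le_add_left c m)
    rw [smul_eq_mul, Ideal.mul_top, Nat.add_sub_cancel] at h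
    rw [h] at ha'
    obtain ⟨b, hb, hab⟩ := Ideal.mem_mul_span_singleton.mp (Ideal.mul_mono_right inf_le_right ha')
    have hab' : g ^ k * (a - b) = 0 := hk _ (by rw [mul_sub, ← hab]; ring)
    have : a • g ^ k • x = 0 := by
      rw [smul_smul, mul_comm, ← sub_add_cancel a b, mul_add, hab', zero_add, mul_smul, hm b hb,
        smul_zero]
    exact this
  obtain ⟨e, he⟩ := hE.extension_property ((LinearMap.ker p).liftQ p le_rfl)
    (LinearMap.ker_eq_bot.mp (Submodule.ker_liftQ_eq_bot' _ _ rfl))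
    ((LinearMap.ker p).liftQ q hpq)
  have he1 := congr($he (Submodule.Quotient.mk 1))
  refine ⟨e (Ideal.Quotient.mk _ 1), ⟨m + c, fun a ha ↦ ?_⟩, k, ?_⟩
  · rw [← map_smul, ← map_zero e]
    congr 1
    exact Ideal.Quotient.eq_zero_iff_mem.mpr (by simpa using ha)
  · simp only [LinearMap.comp_apply, Submodule.liftQ_apply, p, q, LinearMap.toSpanSingleton_apply,
      one_smul] at he1
    rw [smul_sub, sub_eq_zero, ← he1, smul_smul, ← map_smul]
    congr 1
    rw [mul_comm]
    exact congr_arg (Ideal.Quotient.mk _) (mul_one _).symm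

end Ideal

/-- Let `K` be a complex of injective modules over a Noetherian ring, exact in positive degrees.
If `I` has `r` generators, then the subcomplex of `I`-power torsion is exact in degrees `> r`. -/
theorem CochainComplex.exists_d_eq_of_mem_powTorsion {R : Type u} [CommRing R] [IsNoetherianRing R]
    (K : CochainComplex (ModuleCat.{u} R) ℕ) (hinj : ∀ i, Module.Baer R (K.X i))
    (hK : ∀ (i : ℕ) (x : K.X (i + 1)), K.d (i + 1) (i + 2) x = 0 → ∃ y, K.d i (i + 1) y = x)
    {r : ℕ} (f : Fin r → R) {i : ℕ} (hi : r ≤ i) {x : K.X (i + 1)}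
    (hx : x ∈ (Ideal.span (Set.range f)).powTorsion (K.X (i + 1)))
    (hdx : K.d (i + 1) (i + 2) x = 0) :
    ∃ y ∈ (Ideal.span (Set.range f)).powTorsion (K.X i), K.d i (i + 1) y = x := by
  have hd {i j : ℕ} {x : K.X i} {J : Ideal R} (hx : x ∈ J.powTorsion (K.X i)) :
      K.d i j x ∈ J.powTorsion (K.X j) :=
    Ideal.map_mem_powTorsion (K.d i j).hom hx
  induction r generalizing i with
  | zero =>
    obtain ⟨y, hy⟩ := hK i x hdx
    have hbot : Ideal.span (Set.range f) = ⊥ := by simp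
    exact ⟨y, hbot ▸ Ideal.mem_powTorsion_bot y, hy⟩
  | succ r ih =>
    obtain ⟨j, rfl⟩ : ∃ j, i = j + 1 := ⟨i - 1, by lia⟩
    have hspan : Ideal.span (Set.range f) =
        Ideal.span (Set.range (f ∘ Fin.castSucc)) ⊔ Ideal.span {f (Fin.last r)} := by
      rw [← Ideal.span_union]
      congr 1
      ext a
      simp [Fin.exists_fin_succ', eq_comm, or_comm]
    rw [hspan, Ideal.mem_powTorsion_sup_span_singleton_iff] at hx
    obtain ⟨hx, n, hn⟩ := hx
    obtain ⟨y, hyJ, rfl⟩ := ih (f ∘ Fin.castSucc) (by lia) hx hdx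
    obtain ⟨z, hzJ, hz⟩ := ih (f ∘ Fin.castSucc) (i := j) (x := f (Fin.last r) ^ n • y) (by lia)
      (Submodule.smul_mem _ _ hyJ) (by rw [map_smul, hn])
    obtain ⟨w, hwJ, k, hk⟩ := Ideal.exists_pow_smul_sub_eq_zero_of_injective (hinj j) _
      (f (Fin.last r)) n hzJ
    refine ⟨y - K.d j (j + 1) w, ?_, ?_⟩
    · rw [hspan, Ideal.mem_powTorsion_sup_span_singleton_iff]
      refine ⟨Submodule.sub_mem _ hyJ (hd hwJ), k + n, ?_⟩
      rw [pow_add, mul_smul, smul_sub (_ ^ n), ← hz, ← map_smul, ← map_sub, ← map_smul, hk, map_zero]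
    · have : K.d (j + 1) (j + 2) (K.d j (j + 1) w) = 0 := by
        rw [← ModuleCat.comp_apply, K.d_comp_d]; rfl
      rw [map_sub, this, sub_zero]

namespace CategoryTheory

/-- An element of the left derived functor model of `Ext X Y (n + 1)` is killed by the maps that
kill the corresponding class in the derived category. -/
theorem exists_ext_forall_map_eq_zero {R : Type u} [CommRing R] {X Y : ModuleCat.{u} R} {n : ℕ}
    (a : ((Ext R (ModuleCat.{u} R) (n + 1)).obj (Opposite.op X)).obj Y) :
    ∃ α : Abelian.Ext X Y (n + 1), ∀ {X' : ModuleCat.{u} R} (g : X' ⟶ X),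
      (Abelian.Ext.mk₀ g).comp α (zero_add _) = 0 →
        ((Ext R (ModuleCat.{u} R) (n + 1)).map g.op).app Y a = 0 := by
  let F := ((linearYoneda R (ModuleCat.{u} R)).obj Y).rightOp
  let L {X : ModuleCat.{u} R} (P : ProjectiveResolution X) :=
    (F.mapHomologicalComplex (ComplexShape.down ℕ)).obj P.complex
  let e {X : ModuleCat.{u} R} (P : ProjectiveResolution X) :
    (F.leftDerived (n + 1)).obj X ≅ (L P).homology (n + 1) := P.isoLeftDerivedObj F (n + 1)
  let P := projectiveResolution X
  have hmono : Mono ((L P).homologyι (n + 1)) :=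
    HomologicalComplex.instMonoHomologyι ..
  have hepi : Epi ((e P).hom ≫ (L P).homologyι (n + 1)).unop :=
    @unop_epi_of_mono _ _ _ _ _ (mono_comp _ _)
  obtain ⟨b, hb⟩ := (ModuleCat.epi_iff_surjective _).mp hepi a
  let φ : P.complex.X (n + 1) ⟶ Y := ((L P).pOpcycles (n + 1)).unop b
  have hφ : P.complex.d (n + 2) (n + 1) ≫ φ = 0 :=
    congr($(congr_arg Quiver.Hom.unop ((L P).d_pOpcycles (n + 2) (n + 1))) b)
  refine ⟨P.extMk φ (n + 2) rfl hφ, fun {X'} g hg ↦ ?_⟩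
  let P' := projectiveResolution X'
  have hlift : (ProjectiveResolution.lift g P' P).f 0 ≫ P.π.f 0 = P'.π.f 0 ≫ g :=
    ProjectiveResolution.lift_commutes_zero g P' P
  let ψ : ProjectiveResolution.Hom P' P g := ⟨ProjectiveResolution.lift g P' P, hlift⟩
  rw [P.mk₀_comp_extMk _ _ _ _ ψ, P'.extMk_eq_zero_iff _ _ _ _ n rfl] at hg
  obtain ⟨χ, hχ⟩ := hg
  let Lψ : L P' ⟶ L P := (F.mapHomologicalComplex _).map ψ.hom
  have hnat : (F.leftDerived (n + 1)).map g ≫ (e P).hom =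
      (e P').hom ≫ HomologicalComplex.homologyMap Lψ (n + 1) :=
    ProjectiveResolution.isoLeftDerivedObj_hom_naturality g P' P ψ.hom hlift F (n + 1)
  have hnat' : (F.leftDerived (n + 1)).map g ≫ (e P).hom ≫ (L P).homologyι (n + 1) =
      (e P').hom ≫ (L P').homologyι (n + 1) ≫ HomologicalComplex.opcyclesMap Lψ (n + 1) := by
    rw [reassoc_of% hnat, HomologicalComplex.homologyι_naturality]
  have hfac : (L P').homologyπ (n + 1) ≫ (L P').homologyι (n + 1) ≫
      HomologicalComplex.opcyclesMap Lψ (n + 1) =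
      (L P').iCycles (n + 1) ≫ Lψ.f (n + 1) ≫ (L P).pOpcycles (n + 1) := by
    simp
  have hd : (L P').iCycles (n + 1) ≫ (L P').d (n + 1) n = 0 := (L P').iCycles_d _ _
  have hzero :
      ((L P').homologyι (n + 1) ≫ HomologicalComplex.opcyclesMap Lψ (n + 1)).unop b = 0 := by
    have hepi' : Epi ((L P').homologyπ (n + 1)) := HomologicalComplex.instEpiHomologyπ ..
    have : Mono ((L P').homologyπ (n + 1)).unop := unop_mono_of_epi _
    apply (ModuleCat.mono_iff_injective _).mp this
    rw [map_zero]
    refine congr($(congr_arg Quiver.Hom.unop hfac) b).trans ?_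
    change ((L P').iCycles (n + 1)).unop (ψ.hom.f (n + 1) ≫ φ) = 0
    rw [← hχ]
    exact congr($(congr_arg Quiver.Hom.unop hd) χ)
  subst hb
  refine congr($(congr_arg Quiver.Hom.unop hnat') b).trans ?_
  change (e P').hom.unop
    (((L P').homologyι (n + 1) ≫ HomologicalComplex.opcyclesMap Lψ (n + 1)).unop b) = 0
  rw [hzero, map_zero]

end CategoryTheory
namespace localCohomology

/-- Every class in `Ext (R ⧸ I ^ t) M (i + 1)` with `i ≥ r` dies in `Ext (R ⧸ I ^ s) M (i + 1)` for
some `s ≥ t`, if `I` is generated by `r` elements. -/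
theorem exists_mk₀_comp_eq_zero {R : Type u} [CommRing R] [IsNoetherianRing R] {r : ℕ}
    (f : Fin r → R) {i : ℕ} (hi : r ≤ i) (M : ModuleCat.{u} R) (t : ℕ)
    (α : Abelian.Ext
      ((ringModIdeals (idealPowersDiagram (Ideal.span (Set.range f)))).obj (.op t)) M (i + 1)) :
    ∃ (s : ℕ) (h : t ≤ s), (Abelian.Ext.mk₀
      ((ringModIdeals (idealPowersDiagram (Ideal.span (Set.range f)))).map
        (homOfLE h).op)).comp α (zero_add _) = 0 := by
  let E := injectiveResolution M
  obtain ⟨φ, hφ, rfl⟩ := E.extMk_surjective α (i + 2) rfl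
  have hinj (j : ℕ) : Module.Baer R (E.cocomplex.X j) :=
    have : Injective (ModuleCat.of R (E.cocomplex.X j)) := E.injective j
    Module.Baer.of_injective (Module.injective_module_of_injective_object R _)
  obtain ⟨y, ⟨s, hs⟩, hy⟩ := E.cocomplex.exists_d_eq_of_mem_powTorsion hinj
    (fun j x hx ↦ (ShortComplex.moduleCat_exact_iff _).mp (E.exact_succ j) x hx) f hi
    (x := φ (Ideal.Quotient.mk _ 1))
    ⟨t, fun a ha ↦ (φ.hom.map_smul a _).symm.trans <| (congr_arg φ.hom
      (Ideal.Quotient.eq_zero_iff_mem.mpr (Ideal.mul_mem_right 1 _ ha))).trans (map_zero φ.hom)⟩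
    congr($hφ (Ideal.Quotient.mk _ 1))
  refine ⟨max s t, le_max_right s t, ?_⟩
  rw [E.mk₀_comp_extMk, E.extMk_eq_zero_iff _ _ _ _ i rfl]
  refine ⟨ModuleCat.ofHom (Submodule.liftQ _ (LinearMap.toSpanSingleton R _ y) fun a ha ↦
    hs a (Ideal.pow_le_pow_right (le_max_left s t) ha)), ?_⟩
  refine ModuleCat.hom_ext (Submodule.linearMap_qext _ (LinearMap.ext_ring ?_))
  refine Eq.trans ?_ hy
  exact congr_arg (E.cocomplex.d i (i + 1)) (one_smul R y)

end localCohomology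

theorem localCohomology_vanishes_above_number_of_generators
    (R : Type) [CommRing R] [IsNoetherianRing R]
    {r : ℕ} (f : Fin r → R) (I : Ideal R) (hI : I = Ideal.span (Set.range f)) :
    ∀ (M : Type) [AddCommGroup M] [Module R M] (i : ℕ), r < i →
      IsZero ((localCohomology I i).obj (ModuleCat.of R M)) := by
  subst hI
  intro M _ _ i hi
  obtain ⟨i, rfl⟩ : ∃ j, i = j + 1 := ⟨i - 1, by lia⟩
  let D := localCohomology.diagram
    (localCohomology.idealPowersDiagram (Ideal.span (Set.range f))) (i + 1)
  have : HasColimit D := localCohomology.hasColimitDiagram.{0, 0} _ _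
  have hcol : IsColimit (((evaluation _ _).obj (ModuleCat.of R M)).mapCocone (colimit.cocone D)) :=
    isColimitOfPreserves _ (colimit.isColimit D)
  rw [IsZero.iff_id_eq_zero]
  refine hcol.hom_ext fun t ↦ ModuleCat.hom_ext (LinearMap.ext fun a ↦ ?_)
  obtain ⟨α, hα⟩ := exists_ext_forall_map_eq_zero a
  obtain ⟨s, h, hs⟩ := localCohomology.exists_mk₀_comp_eq_zero f (Nat.lt_succ_iff.mp hi) _ _ α
  have hw := colimit.w D (homOfLE h).op.op
  have ha : (colimit.ι D t).app (ModuleCat.of R M) a = 0 := by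
    refine congr($(congr_app hw.symm (ModuleCat.of R M)) a).trans ?_
    exact (congr_arg ((colimit.ι D (.op (.op s))).app (ModuleCat.of R M)) (hα _ hs)).trans
      (map_zero _)
  exact ha
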